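/- Let n ≥ 2 and r ≥ 4 be integers and S = k[α_0,…,α_n]. Let I_0 ⊆ S be the ideal generated by: all monomials of degree r−2 that are divisible by at least one of α_0,…,α_{n−2} except the monomial α_{n−2}·α_n^{r−3}, together with the two monomials α_{n−2}·α_n^{r−2} and α_{n−1}^r. Then dim_k Hom_S(I_0, S/I_0)_0 ≤ C(n+r−2, n) + 2n − 1, where Hom_S(I_0, S/I_0)_0 is the k-vector space of degree-preserving S-module homomorphisms from I_0 to S/I_0. -/

import Mathlib

open MvPolynomial

/-- The image of the space of homogeneous polynomials of degree `d` in `S/I`: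
the degree-`d` graded piece of `S/I`. -/
noncomputable def quotPiece (k : Type*) [Field k] (n : ℕ)
    (I : Ideal (MvPolynomial (Fin (n+1)) k)) (d : ℕ) :
    Submodule k (MvPolynomial (Fin (n+1)) k ⧸ I) :=
  (homogeneousSubmodule (Fin (n+1)) k d).map (Ideal.Quotient.mkₐ k I).toLinearMap

/-- The `k`-vector space `Hom_S(J, S/I)₀` of degree-preserving `S`-module homomorphisms
`J → S/I`. -/
noncomputable def Hom0 (k : Type*) [Field k] (n : ℕ)
    (J I : Ideal (MvPolynomial (Fin (n+1)) k)) :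
    Submodule k ((↥J) →ₗ[MvPolynomial (Fin (n+1)) k] (MvPolynomial (Fin (n+1)) k ⧸ I)) where
  carrier := {φ | ∀ (d : ℕ) (f : ↥J), (f : MvPolynomial (Fin (n+1)) k).IsHomogeneous d →
    φ f ∈ quotPiece k n I d}
  add_mem' := fun h1 h2 d f hf => by
    simpa using Submodule.add_mem _ (h1 d f hf) (h2 d f hf)
  zero_mem' := fun d f hf => by simp
  smul_mem' := fun c φ h d f hf => by
    simpa using Submodule.smul_mem _ c (h d f hf)

namespace HomBound

set_option linter.unusedSectionVars false
set_option linter.unusedSimpArgs false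

variable {σ : Type*} [Fintype σ] [DecidableEq σ]

/-- Exponents of the generators of the ideal. -/
def Gen (W Y Z : σ) (m : ℕ) : Set (σ →₀ ℕ) :=
  {c | c.degree = m ∧ (∃ i, i ≠ Y ∧ i ≠ Z ∧ c i ≠ 0) ∧
      c ≠ Finsupp.single W 1 + Finsupp.single Z (m - 1)} ∪
    {Finsupp.single W 1 + Finsupp.single Z m, Finsupp.single Y (m + 2)}

/-- Exponents of the monomials of the ideal. -/
def Mem (W Y Z : σ) (m : ℕ) (u : σ →₀ ℕ) : Prop := ∃ c ∈ Gen W Y Z m, c ≤ u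

/-- The exponent of `y^a z^b`. -/
noncomputable def yz (Y Z : σ) (a b : ℕ) : σ →₀ ℕ := Finsupp.single Y a + Finsupp.single Z b

theorem yz_succ_left (Y Z : σ) (a b : ℕ) : yz Y Z (a + 1) b = yz Y Z a b + Finsupp.single Y 1 := by
  simp only [yz, Finsupp.single_add]; abel

theorem yz_succ_right (Y Z : σ) (a b : ℕ) : yz Y Z a (b + 1) = yz Y Z a b + Finsupp.single Z 1 := by
  simp only [yz, Finsupp.single_add]; abel

theorem yz_degree (Y Z : σ) (a b : ℕ) : (yz Y Z a b).degree = a + b := by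
  simp [yz]

theorem yz_apply_x {Y Z i : σ} (hY : i ≠ Y) (hZ : i ≠ Z) (a b : ℕ) : yz Y Z a b i = 0 := by
  simp [yz, Finsupp.single_apply, hY.symm, hZ.symm]

theorem yz_apply_Y {Y Z : σ} (h : Y ≠ Z) (a b : ℕ) : yz Y Z a b Y = a := by
  simp [yz, Finsupp.single_apply, h.symm]

theorem yz_apply_Z {Y Z : σ} (h : Y ≠ Z) (a b : ℕ) : yz Y Z a b Z = b := by
  simp [yz, Finsupp.single_apply, h]

theorem eq_yz {Y Z : σ} (h : Y ≠ Z) (u : σ →₀ ℕ) (hu : ∀ i, i ≠ Y → i ≠ Z → u i = 0) :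
    u = yz Y Z (u Y) (u Z) := by
  ext i
  by_cases hY : i = Y
  · subst hY; rw [yz_apply_Y h]
  by_cases hZ : i = Z
  · subst hZ; rw [yz_apply_Z h]
  rw [yz_apply_x hY hZ, hu i hY hZ]

theorem single_le {u : σ →₀ ℕ} {i : σ} (h : u i ≠ 0) : Finsupp.single i 1 ≤ u := by
  rw [Finsupp.single_le_iff]; omega

theorem exists_sub {u : σ →₀ ℕ} {i : σ} (h : u i ≠ 0) : ∃ v, u = v + Finsupp.single i 1 :=
  ⟨u - Finsupp.single i 1, (tsub_add_cancel_of_le (single_le h)).symm⟩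

theorem exists_ne_zero {u : σ →₀ ℕ} (h : u.degree ≠ 0) : ∃ i, u i ≠ 0 := by
  by_contra hc
  push Not at hc
  apply h
  have : u = 0 := by ext i; simp [hc]
  simp [this]

theorem exists_le_degree (d : ℕ) : ∀ u : σ →₀ ℕ, d ≤ u.degree → ∃ v ≤ u, v.degree = d := by
  induction d with
  | zero => intro u _; exact ⟨0, zero_le, by simp⟩
  | succ d ih =>
    intro u hu
    obtain ⟨i, hi⟩ := exists_ne_zero (u := u) (by omega)
    obtain ⟨v, rfl⟩ := exists_sub hi
    obtain ⟨w, hw, hd⟩ := ih v (by simp at hu; omega)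
    exact ⟨w + Finsupp.single i 1, by gcongr, by simp [hd]⟩

section
variable {W Y Z : σ} {m : ℕ}

theorem Mem.mono {u v : σ →₀ ℕ} (h : Mem W Y Z m u) (huv : u ≤ v) : Mem W Y Z m v := by
  obtain ⟨c, hc, hl⟩ := h
  exact ⟨c, hc, hl.trans huv⟩

theorem mem_of_gen {u : σ →₀ ℕ} (h : u ∈ Gen W Y Z m) : Mem W Y Z m u := ⟨u, h, le_rfl⟩

theorem std_yz (hWY : W ≠ Y) (hWZ : W ≠ Z) (hYZ : Y ≠ Z) {a b : ℕ} (ha : a < m + 2) :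
    ¬ Mem W Y Z m (yz Y Z a b) := by
  rintro ⟨c, hc, hl⟩
  rcases hc with ⟨-, ⟨i, hY, hZ, hi⟩, -⟩ | rfl | rfl
  · have := hl i
    rw [yz_apply_x hY hZ] at this
    omega
  · have := hl W
    rw [yz_apply_x hWY hWZ] at this
    simp at this
  · have := hl Y
    rw [yz_apply_Y hYZ] at this
    simp at this
    omega

theorem mem_of_degree (hWY : W ≠ Y) (hWZ : W ≠ Z) (hm : 2 ≤ m) {u : σ →₀ ℕ}
    (hd : m + 1 ≤ u.degree) {i : σ} (hY : i ≠ Y) (hZ : i ≠ Z) (hi : u i ≠ 0) :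
    Mem W Y Z m u := by
  obtain ⟨v, rfl⟩ := exists_sub hi
  simp at hd
  obtain ⟨c, hcv, hcd⟩ := exists_le_degree (m - 1) v (by omega)
  by_cases hc : c + Finsupp.single i 1 = Finsupp.single W 1 + Finsupp.single Z (m - 1)
  · have hiW : i = W := by
      by_contra hne
      have := DFunLike.congr_fun hc i
      simp [Finsupp.single_apply, Ne.symm hne, hZ.symm] at this
    subst hiW
    have hcz : c = Finsupp.single Z (m - 1) := by
      rw [add_comm] at hc; exact add_left_cancel hc
    subst hcz
    obtain ⟨t, rfl⟩ := exists_add_of_le hcv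
    simp only [map_add, Finsupp.degree_single] at hd
    obtain ⟨j, hj⟩ := exists_ne_zero (u := t) (by omega)
    obtain ⟨s, rfl⟩ := exists_sub hj
    by_cases hjZ : j = Z
    · subst hjZ
      refine ⟨Finsupp.single i 1 + Finsupp.single j m, Or.inr (Or.inl rfl), ?_⟩
      obtain ⟨q, rfl⟩ : ∃ q, m = q + 1 := ⟨m - 1, by omega⟩
      have : Finsupp.single j (q + 1 - 1) + (s + Finsupp.single j 1) + Finsupp.single i 1
        = (Finsupp.single i 1 + Finsupp.single j (q + 1)) + s := by
        simp only [Finsupp.single_add, Nat.add_sub_cancel]; abel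
      rw [this]
      exact le_self_add
    · obtain ⟨q, rfl⟩ : ∃ q, m = q + 2 := ⟨m - 2, by omega⟩
      refine ⟨Finsupp.single i 1 + Finsupp.single Z q + Finsupp.single j 1,
        Or.inl ⟨by simp; omega, ⟨i, hY, hZ, by simp⟩, ?_⟩, ?_⟩
      · intro h
        have := DFunLike.congr_fun h Z
        simp [Finsupp.single_apply, hZ, hjZ] at this
      · have : Finsupp.single Z (q + 2 - 1) + (s + Finsupp.single j 1) + Finsupp.single i 1
          = (Finsupp.single i 1 + Finsupp.single Z q + Finsupp.single j 1)
            + (s + Finsupp.single Z 1) := by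
          have : q + 2 - 1 = q + 1 := by omega
          rw [this]
          simp only [Finsupp.single_add]; abel
        rw [this]
        exact le_self_add
  · exact ⟨c + Finsupp.single i 1, Or.inl ⟨by simp; omega, ⟨i, hY, hZ, by simp⟩, hc⟩, by gcongr⟩

theorem std_cases (hWY : W ≠ Y) (hWZ : W ≠ Z) (hYZ : Y ≠ Z) (hm : 2 ≤ m) {u : σ →₀ ℕ}
    (hd : m ≤ u.degree) (hs : ¬ Mem W Y Z m u) :
    (u = Finsupp.single W 1 + Finsupp.single Z (m - 1)) ∨
      ∃ a b, u = yz Y Z a b ∧ a + b = u.degree ∧ a < m + 2 := by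
  by_cases hx : ∃ i, i ≠ Y ∧ i ≠ Z ∧ u i ≠ 0
  · left
    by_contra hne
    obtain ⟨i, hY, hZ, hi⟩ := hx
    rcases hd.eq_or_lt with h | h
    · exact hs (mem_of_gen (Or.inl ⟨h.symm, ⟨i, hY, hZ, hi⟩, hne⟩))
    · exact hs (mem_of_degree hWY hWZ hm h hY hZ hi)
  · right
    push Not at hx
    have := eq_yz hYZ u hx
    refine ⟨u Y, u Z, this, by conv_rhs => rw [this, yz_degree], ?_⟩
    by_contra hlt
    apply hs
    refine ⟨Finsupp.single Y (m + 2), Or.inr (Or.inr rfl), ?_⟩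
    rw [Finsupp.single_le_iff]; omega

theorem mem_x (hYZ : Y ≠ Z) {i : σ} (hY : i ≠ Y) (hZ : i ≠ Z) {a b : ℕ} (h : m ≤ a + b + 1)
    (ha : i ≠ W ∨ 1 ≤ a) (ham : a + 1 ≤ m) :
    Mem W Y Z m (Finsupp.single i 1 + yz Y Z a b) := by
  refine ⟨Finsupp.single i 1 + yz Y Z a (m - 1 - a),
    Or.inl ⟨by rw [map_add, yz_degree]; simp; omega, ⟨i, hY, hZ, by simp⟩, ?_⟩, ?_⟩
  · intro he
    rcases ha with ha | ha
    · have := DFunLike.congr_fun he i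
      simp [Finsupp.single_apply, ha.symm, hZ.symm] at this
    · have := DFunLike.congr_fun he Y
      simp [Finsupp.single_apply, hY, hYZ.symm, yz_apply_Y hYZ] at this
      subst this
      have := DFunLike.congr_fun he Z
      simp [Finsupp.single_apply, hZ, hYZ.symm, yz_apply_Z hYZ] at this
      omega
  · gcongr
    unfold yz
    gcongr
    simp
    omega


theorem kernel_zero {k : Type*} [Zero k] (hWY : W ≠ Y) (hWZ : W ≠ Z) (hYZ : Y ≠ Z) (hm : 2 ≤ m)
    (T : (σ →₀ ℕ) → (σ →₀ ℕ) → k)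
    (T1 : ∀ g u i, Mem W Y Z m g → ¬ Mem W Y Z m (u + Finsupp.single i 1) →
      T (g + Finsupp.single i 1) (u + Finsupp.single i 1) = T g u)
    (T2 : ∀ g u i, Mem W Y Z m g → ¬ Mem W Y Z m u → u i = 0 →
      T (g + Finsupp.single i 1) u = 0)
    (T3 : ∀ g u, Mem W Y Z m g → ¬ Mem W Y Z m u → u.degree ≠ g.degree → T g u = 0)
    (h1 : ∀ g ∈ Gen W Y Z m, g.degree = m →
      T g (Finsupp.single W 1 + Finsupp.single Z (m - 1)) = 0)
    (h2 : ∀ a b, a < m + 2 → a + b = m + 2 → T (Finsupp.single Y (m + 2)) (yz Y Z a b) = 0)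
    (h3 : ∀ i, i ≠ Y → i ≠ Z → i ≠ W → ∀ e < 2,
      T (Finsupp.single i 1 + yz Y Z 0 (m - 1)) (yz Y Z e (m - e)) = 0)
    (h4 : ∀ e, (e = 0 ∨ e = 1 ∨ e = m + 1) →
      T (Finsupp.single W 1 + yz Y Z 0 m) (yz Y Z e (m + 1 - e)) = 0)
    (g u : σ →₀ ℕ) (hg : g ∈ Gen W Y Z m) (hu : ¬ Mem W Y Z m u) : T g u = 0 := by
  have sy : ∀ {a b : ℕ}, a < m + 2 → ¬ Mem W Y Z m (yz Y Z a b) := fun h => std_yz hWY hWZ hYZ h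
  -- the basic moves
  have mY : ∀ i a b e f, Mem W Y Z m (Finsupp.single i 1 + yz Y Z a b) → e + 1 < m + 2 →
      T (Finsupp.single i 1 + yz Y Z (a + 1) b) (yz Y Z (e + 1) f)
        = T (Finsupp.single i 1 + yz Y Z a b) (yz Y Z e f) := by
    intro i a b e f hM he
    have := T1 _ (yz Y Z e f) Y hM (by rw [← yz_succ_left]; exact sy he)
    rwa [add_assoc, ← yz_succ_left, ← yz_succ_left] at this
  have mZ : ∀ i a b e f, Mem W Y Z m (Finsupp.single i 1 + yz Y Z a b) → e < m + 2 →
      T (Finsupp.single i 1 + yz Y Z a (b + 1)) (yz Y Z e (f + 1))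
        = T (Finsupp.single i 1 + yz Y Z a b) (yz Y Z e f) := by
    intro i a b e f hM he
    have := T1 _ (yz Y Z e f) Z hM (by rw [← yz_succ_right]; exact sy he)
    rwa [add_assoc, ← yz_succ_right, ← yz_succ_right] at this
  have zY : ∀ i a b f, Mem W Y Z m (Finsupp.single i 1 + yz Y Z a b) →
      T (Finsupp.single i 1 + yz Y Z (a + 1) b) (yz Y Z 0 f) = 0 := by
    intro i a b f hM
    have := T2 _ (yz Y Z 0 f) Y hM (sy (by omega)) (yz_apply_Y hYZ _ _)
    rwa [add_assoc, ← yz_succ_left] at this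
  have zZ : ∀ i a b e, Mem W Y Z m (Finsupp.single i 1 + yz Y Z a b) → e < m + 2 →
      T (Finsupp.single i 1 + yz Y Z a (b + 1)) (yz Y Z e 0) = 0 := by
    intro i a b e hM he
    have := T2 _ (yz Y Z e 0) Z hM (sy he) (yz_apply_Z hYZ _ _)
    rwa [add_assoc, ← yz_succ_right] at this
  -- the recursion
  have rec1 : ∀ i, i ≠ Y → i ≠ Z → ∀ a b e f, (i ≠ W ∨ 1 ≤ a) → a + b + 2 = m →
      e + f + 1 = m →
      T (Finsupp.single i 1 + yz Y Z (a + 1) b) (yz Y Z (e + 1) f)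
       = T (Finsupp.single i 1 + yz Y Z a (b + 1)) (yz Y Z e (f + 1)) := by
    intro i hY hZ a b e f ha hab hef
    rw [← mY i a (b + 1) e (f + 1) (mem_x hYZ hY hZ (by omega) ha (by omega)) (by omega),
      ← mZ i (a + 1) b (e + 1) f
        (mem_x hYZ hY hZ (by omega) (Or.inr (by omega)) (by omega)) (by omega)]
  have top : ∀ i, i ≠ Y → i ≠ Z → ∀ a b, (i ≠ W ∨ 1 ≤ a) → a + b + 2 = m →
      T (Finsupp.single i 1 + yz Y Z a (b + 1)) (yz Y Z m 0) = 0 := by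
    intro i hY hZ a b ha hab
    rw [← mY i a (b + 1) m 0 (mem_x hYZ hY hZ (by omega) ha (by omega)) (by omega)]
    exact zZ i (a + 1) b (m + 1)
      (mem_x hYZ hY hZ (by omega) (Or.inr (by omega)) (by omega)) (by omega)
  have bot : ∀ i, i ≠ Y → i ≠ Z → ∀ a b, (i ≠ W ∨ 1 ≤ a) → a + b + 2 = m →
      T (Finsupp.single i 1 + yz Y Z (a + 1) b) (yz Y Z 0 m) = 0 := by
    intro i hY hZ a b ha hab
    rw [← mZ i (a + 1) b 0 m
      (mem_x hYZ hY hZ (by omega) (Or.inr (by omega)) (by omega)) (by omega)]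
    exact zY i a (b + 1) _ (mem_x hYZ hY hZ (by omega) ha (by omega))
  have up : ∀ i, i ≠ Y → i ≠ Z → ∀ f a b e, (i ≠ W ∨ 1 ≤ a) → a + b + 2 = m →
      e + f = m → a + 2 ≤ e →
      T (Finsupp.single i 1 + yz Y Z a (b + 1)) (yz Y Z e f) = 0 := by
    intro i hY hZ f
    induction f with
    | zero =>
      intro a b e ha hab hef _
      obtain rfl : e = m := by omega
      exact top i hY hZ a b ha hab
    | succ f ih =>
      intro a b e ha hab hef hae
      obtain ⟨b, rfl⟩ : ∃ c, b = c + 1 := ⟨b - 1, by omega⟩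
      rw [← rec1 i hY hZ a (b + 1) e f ha hab (by omega)]
      exact ih (a + 1) b (e + 1) (Or.inr (by omega)) (by omega) (by omega) (by omega)
  have down : ∀ i, i ≠ Y → i ≠ Z → ∀ a0, (i ≠ W ∨ 1 ≤ a0) →
      (∀ b e f, a0 + b + 1 = m → e + f = m →
        T (Finsupp.single i 1 + yz Y Z a0 b) (yz Y Z e f) = 0) →
      ∀ t b e f, a0 + t + b + 1 = m → e + f = m →
        T (Finsupp.single i 1 + yz Y Z (a0 + t) b) (yz Y Z e f) = 0 := by
    intro i hY hZ a0 ha0 hbase t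
    induction t with
    | zero => exact hbase
    | succ t ih =>
      intro b e f hab hef
      have hat : i ≠ W ∨ 1 ≤ a0 + t := ha0.imp id (fun h => by omega)
      cases e with
      | zero =>
        obtain rfl : f = m := by omega
        exact bot i hY hZ (a0 + t) b hat (by omega)
      | succ e =>
        have := rec1 i hY hZ (a0 + t) b e f hat (by omega) (by omega)
        rw [← add_assoc, this]
        exact ih (b + 1) e (f + 1) (by omega) (by omega)
  -- i ≠ W
  have px : ∀ i, i ≠ Y → i ≠ Z → i ≠ W → ∀ a b e f, a + b + 1 = m → e + f = m →
      T (Finsupp.single i 1 + yz Y Z a b) (yz Y Z e f) = 0 := by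
    intro i hY hZ hW a b e f hab hef
    have := down i hY hZ 0 (Or.inl hW) (by
      intro b e f hb hef
      by_cases he : e < 2
      · have := h3 i hY hZ hW e he
        rwa [show m - 1 = b by omega, show m - e = f by omega] at this
      · obtain ⟨b, rfl⟩ : ∃ c, b = c + 1 := ⟨b - 1, by omega⟩
        exact up i hY hZ f 0 b e (Or.inl hW) (by omega) hef (by omega)) a b e f (by omega) hef
    rwa [zero_add] at this
  have memW : ∀ b, m ≤ b → Mem W Y Z m (Finsupp.single W 1 + yz Y Z 0 b) := by
    intro b hb
    refine ⟨_, Or.inr (Or.inl rfl), ?_⟩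
    simp only [yz, Finsupp.single_zero, zero_add]
    gcongr
  -- `y P = z² p₁`
  have link : ∀ b e f, b + 2 = m → e + f + 1 = m →
      T (Finsupp.single W 1 + yz Y Z 1 b) (yz Y Z (e + 1) f)
        = T (Finsupp.single W 1 + yz Y Z 0 m) (yz Y Z e (f + 2)) := by
    intro b e f hb hef
    rw [← mY W 0 m e (f + 2) (memW m le_rfl) (by omega)]
    obtain rfl := hb
    rw [mZ W (0 + 1) (b + 1) (e + 1) (f + 1)
      (mem_x hYZ hWY hWZ (by omega) (Or.inr (by omega)) (by omega)) (by omega),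
      mZ W (0 + 1) b (e + 1) f
      (mem_x hYZ hWY hWZ (by omega) (Or.inr (by omega)) (by omega)) (by omega)]
  have link0 : ∀ b, b + 2 = m →
      T (Finsupp.single W 1 + yz Y Z 1 b) (yz Y Z 0 m) = 0 := by
    intro b hb
    rw [← mZ W 1 b 0 m
      (mem_x hYZ hWY hWZ (by omega) (Or.inr (by omega)) (by omega)) (by omega),
      ← mZ W 1 (b + 1) 0 (m + 1)
      (mem_x hYZ hWY hWZ (by omega) (Or.inr (by omega)) (by omega)) (by omega)]
    exact zY W 0 _ _ (memW _ (by omega))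
  have P : ∀ e f, e + f = m + 1 →
      T (Finsupp.single W 1 + yz Y Z 0 m) (yz Y Z e f) = 0 := by
    intro e f hef
    by_cases hs : e = 0 ∨ e = 1 ∨ e = m + 1
    · have := h4 e hs
      rwa [show m + 1 - e = f by omega] at this
    · by_cases hem : e = m
      · subst hem
        obtain rfl : f = 1 := by omega
        rw [← mY W 0 e e 1 (memW e le_rfl) (by omega)]
        obtain ⟨b, rfl⟩ : ∃ b, e = b + 1 := ⟨e - 1, by omega⟩
        rw [mZ W (0 + 1) b (b + 1 + 1) 0
          (mem_x hYZ hWY hWZ (by omega) (Or.inr (by omega)) (by omega)) (by omega)]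
        obtain ⟨b, rfl⟩ : ∃ c, b = c + 1 := ⟨b - 1, by omega⟩
        exact zZ W (0 + 1) b _
          (mem_x hYZ hWY hWZ (by omega) (Or.inr (by omega)) (by omega)) (by omega)
      · obtain ⟨f, rfl⟩ : ∃ c, f = c + 2 := ⟨f - 2, by omega⟩
        obtain ⟨b, hb⟩ : ∃ b, b + 3 = m := ⟨m - 3, by omega⟩
        rw [← link (b + 1) e f (by omega) (by omega)]
        exact up W hWY hWZ f 1 b (e + 1) (Or.inr (by omega)) (by omega) (by omega) (by omega)
  have pW : ∀ a b e f, 1 ≤ a → a + b + 1 = m → e + f = m →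
      T (Finsupp.single W 1 + yz Y Z a b) (yz Y Z e f) = 0 := by
    intro a b e f ha hab hef
    obtain ⟨t, rfl⟩ : ∃ t, a = 1 + t := ⟨a - 1, by omega⟩
    refine down W hWY hWZ 1 (Or.inr le_rfl) ?_ t b e f hab hef
    intro b e f hb hef
    cases e with
    | zero =>
      obtain rfl : f = m := by omega
      exact link0 b (by omega)
    | succ e =>
      rw [link b e f (by omega) (by omega)]
      exact P _ _ (by omega)
  -- conclusion
  have hgM := mem_of_gen hg
  have hg0 := hg
  by_cases hdeg : u.degree ≠ g.degree
  · exact T3 g u hgM hu hdeg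
  push Not at hdeg
  rcases hg with hg' | rfl | rfl
  · obtain ⟨hd, ⟨i, hY, hZ, hi⟩, hne⟩ := id hg'
    rcases std_cases hWY hWZ hYZ hm (by omega) hu with rfl | ⟨e, f, rfl, hef, he⟩
    · exact h1 g hg0 hd
    · rw [hdeg, hd] at hef
      obtain ⟨v, rfl⟩ := exists_sub hi
      by_cases hx : ∃ j, j ≠ Y ∧ j ≠ Z ∧ v j ≠ 0
      · obtain ⟨j, hjY, hjZ, hj⟩ := hx
        rw [← T1 _ (yz Y Z e f) Y hgM (by rw [← yz_succ_left]; exact sy (by omega)),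
          ← yz_succ_left, add_right_comm]
        refine T2 _ _ i (mem_of_gen (Or.inl ⟨?_, ⟨j, hjY, hjZ, ?_⟩, ?_⟩)) (sy (by omega))
          (yz_apply_x hY hZ _ _)
        · simpa using hd
        · simp [hj]
        · intro h
          have := DFunLike.congr_fun h Y
          simp [hWY, hYZ.symm] at this
      · push Not at hx
        have hv := eq_yz hYZ v hx
        generalize v Y = a at hv
        generalize v Z = b at hv
        subst hv
        rw [map_add, yz_degree, Finsupp.degree_single] at hd
        rw [add_comm (yz Y Z a b)] at hne ⊢
        by_cases hW : i = W
        · subst hW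
          refine pW a b e f ?_ hd hef
          by_contra ha
          obtain rfl : a = 0 := by omega
          apply hne
          rw [show m - 1 = b by omega]
          simp [yz]
        · exact px i hY hZ hW a b e f hd hef
  · simp only [map_add, Finsupp.degree_single] at hdeg
    rcases std_cases hWY hWZ hYZ hm (by omega) hu with rfl | ⟨e, f, rfl, hef, he⟩
    · simp only [map_add, Finsupp.degree_single] at hdeg
      omega
    · have := P e f (by omega)
      simpa [yz] using this
  · simp only [Finsupp.degree_single] at hdeg
    rcases std_cases hWY hWZ hYZ hm (by omega) hu with rfl | ⟨e, f, rfl, hef, he⟩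
    · simp only [map_add, Finsupp.degree_single] at hdeg
      omega
    · exact h2 e f he (by omega)

end
end HomBound

namespace HomBound
section

variable (k : Type*) [Field k] (n : ℕ) (I : Ideal (MvPolynomial (Fin (n+1)) k))

open Classical in
/-- The coefficient functional on `S/I` (zero if it is not well defined). -/
noncomputable def coeffQ (u : Fin (n+1) →₀ ℕ) :
    (MvPolynomial (Fin (n+1)) k ⧸ I) →ₗ[k] k :=
  if h : (∀ f ∈ I, coeff u f = 0) then
    (Submodule.liftQ (I.restrictScalars k) (lcoeff k u) (fun f hf => h f hf)) ∘ₗ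
      (Submodule.Quotient.restrictScalarsEquiv k I).symm.toLinearMap
  else 0

theorem coeffQ_mk {u : Fin (n+1) →₀ ℕ} (h : ∀ f ∈ I, coeff u f = 0)
    (f : MvPolynomial (Fin (n+1)) k) :
    coeffQ k n I u (Ideal.Quotient.mk I f) = coeff u f := by
  rw [coeffQ, dif_pos h]
  rfl

open Classical in
/-- The matrix entries of `φ`. -/
noncomputable def entry (g u : Fin (n+1) →₀ ℕ) : (Hom0 k n I I) →ₗ[k] k :=
  if h : monomial g 1 ∈ I then
    { toFun := fun φ => coeffQ k n I u (φ.1 ⟨monomial g 1, h⟩)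
      map_add' := fun φ ψ => by simp
      map_smul' := fun c φ => by simp }
  else 0

theorem entry_apply {g u : Fin (n+1) →₀ ℕ} (h : monomial g 1 ∈ I) (φ : Hom0 k n I I) :
    entry k n I g u φ = coeffQ k n I u (φ.1 ⟨monomial g 1, h⟩) := by
  rw [entry, dif_pos h]; rfl

end

theorem finrank_bound (k : Type*) [Field k] (n m : ℕ) (hn : 2 ≤ n) (hm : 2 ≤ m)
    (W Y Z : Fin (n+1)) (hWY : W ≠ Y) (hWZ : W ≠ Z) (hYZ : Y ≠ Z)
    (I : Ideal (MvPolynomial (Fin (n+1)) k))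
    (hI : I = Ideal.span ((fun s => monomial s (1 : k)) '' Gen W Y Z m)) :
    Module.finrank k (Hom0 k n I I) ≤ (n + m).choose n + 2 * (n - 2) + 3 := by
  classical
  have memI : ∀ f, f ∈ I ↔ ∀ x ∈ f.support, Mem W Y Z m x := by
    intro f
    rw [hI, mem_ideal_span_monomial_image]
    rfl
  have memM : ∀ g, Mem W Y Z m g → monomial g (1 : k) ∈ I := by
    intro g hg
    rw [memI]
    intro x hx
    have := support_monomial_subset hx
    simp at this
    rwa [this]
  have std : ∀ u, ¬ Mem W Y Z m u → ∀ f ∈ I, coeff u f = 0 := by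
    intro u hu f hf
    by_contra hc
    exact hu ((memI f).1 hf u (mem_support_iff.2 hc))
  let A := {c // c ∈ (Finset.univ : Finset (Fin (n+1))).finsuppAntidiag m}
  let B := {i : Fin (n+1) // i ∉ ({W, Y, Z} : Finset (Fin (n+1)))}
  let y : (Fin (n+1) →₀ ℕ) := Finsupp.single Y (m + 2)
  let w : (Fin (n+1) →₀ ℕ) := Finsupp.single W 1 + Finsupp.single Z (m - 1)
  let fA : A → (Hom0 k n I I →ₗ[k] k) := fun c =>
    if c.1 ∈ Gen W Y Z m then entry k n I c.1 w
    else if c.1 = w then entry k n I y (yz Y Z (m + 1) 1)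
    else entry k n I y (yz Y Z (c.1 Y) (m + 2 - c.1 Y))
  let fB : B × Fin 2 → (Hom0 k n I I →ₗ[k] k) := fun p =>
    entry k n I (Finsupp.single p.1.1 1 + yz Y Z 0 (m - 1)) (yz Y Z p.2 (m - p.2))
  let e3 : Fin 3 → ℕ := ![0, 1, m + 1]
  let fC : Fin 3 → (Hom0 k n I I →ₗ[k] k) := fun j =>
    entry k n I (Finsupp.single W 1 + yz Y Z 0 m) (yz Y Z (e3 j) (m + 1 - e3 j))
  let F : Hom0 k n I I →ₗ[k] (A ⊕ (B × Fin 2) ⊕ Fin 3 → k) :=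
    LinearMap.pi (Sum.elim fA (Sum.elim fB fC))
  have hinj : Function.Injective F := by
    suffices hker : ∀ φ, F φ = 0 → φ = 0 by
      intro a b hab
      have h0 : F (a + (-1 : k) • b) = 0 := by
        rw [map_add, map_smul, hab]
        simp
      have h1 := hker _ h0
      ext1
      ext1 x
      have h2 : a.1 x + (-1 : k) • b.1 x = 0 := by
        have := congr_arg (fun ψ : Hom0 k n I I => ψ.1 x) h1
        exact this
      rw [neg_one_smul, ← sub_eq_add_neg] at h2
      exact sub_eq_zero.1 h2
    intro φ hφ
    have HA : ∀ c, fA c φ = 0 := fun c => congr_fun hφ (Sum.inl c)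
    have HB : ∀ c, fB c φ = 0 := fun c => congr_fun hφ (Sum.inr (Sum.inl c))
    have HC : ∀ c, fC c φ = 0 := fun c => congr_fun hφ (Sum.inr (Sum.inr c))
    have memA : ∀ c : Fin (n+1) →₀ ℕ, c.degree = m →
        c ∈ (Finset.univ : Finset (Fin (n+1))).finsuppAntidiag m := by
      intro c hc
      rw [Finset.mem_finsuppAntidiag, ← Finsupp.degree_eq_sum]
      exact ⟨hc, Finset.subset_univ _⟩
    have hw : w ∉ Gen W Y Z m := by
      rintro (⟨-, -, h⟩ | h | h)
      · exact h rfl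
      · have := congr_arg Finsupp.degree h
        simp only [w, map_add, Finsupp.degree_single] at this
        omega
      · have := congr_arg Finsupp.degree h
        simp only [w, map_add, Finsupp.degree_single] at this
        omega
    have key := kernel_zero hWY hWZ hYZ hm (fun g u => entry k n I g u φ)
      (by
        intro g u i hg hu
        have hu' : ¬ Mem W Y Z m u := fun h => hu (h.mono le_self_add)
        have hgi : Mem W Y Z m (g + Finsupp.single i 1) := hg.mono le_self_add
        rw [entry_apply k n I (memM _ hg), entry_apply k n I (memM _ hgi)]
        have : (⟨monomial (g + Finsupp.single i 1) 1, memM _ hgi⟩ : I)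
            = (X i : MvPolynomial (Fin (n+1)) k) • ⟨monomial g 1, memM _ hg⟩ := by
          ext1
          simp [X, monomial_mul, add_comm]
        rw [this, map_smul]
        obtain ⟨f, hf⟩ := Ideal.Quotient.mk_surjective (φ.1 ⟨monomial g 1, memM _ hg⟩)
        rw [← hf, ← Ideal.Quotient.mk_eq_mk, ← Submodule.Quotient.mk_smul,
          Ideal.Quotient.mk_eq_mk, Ideal.Quotient.mk_eq_mk, coeffQ_mk k n I (std _ hu),
          coeffQ_mk k n I (std _ hu'), smul_eq_mul, mul_comm, coeff_mul_X])
      (by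
        intro g u i hg hu hui
        have hgi : Mem W Y Z m (g + Finsupp.single i 1) := hg.mono le_self_add
        rw [entry_apply k n I (memM _ hgi)]
        have : (⟨monomial (g + Finsupp.single i 1) 1, memM _ hgi⟩ : I)
            = (X i : MvPolynomial (Fin (n+1)) k) • ⟨monomial g 1, memM _ hg⟩ := by
          ext1
          simp [X, monomial_mul, add_comm]
        rw [this, map_smul]
        obtain ⟨f, hf⟩ := Ideal.Quotient.mk_surjective (φ.1 ⟨monomial g 1, memM _ hg⟩)
        rw [← hf, ← Ideal.Quotient.mk_eq_mk, ← Submodule.Quotient.mk_smul,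
          Ideal.Quotient.mk_eq_mk, coeffQ_mk k n I (std _ hu),
          smul_eq_mul, mul_comm, coeff_mul_X', if_neg (by simpa using hui)])
      (by
        intro g u hg hu hd
        rw [entry_apply k n I (memM _ hg)]
        obtain ⟨f, hf, hfe⟩ := φ.2 g.degree ⟨monomial g 1, memM _ hg⟩
          (isHomogeneous_monomial _ rfl)
        rw [← hfe]
        change coeffQ k n I u (Ideal.Quotient.mk I f) = 0
        rw [coeffQ_mk k n I (std _ hu)]
        exact IsHomogeneous.coeff_eq_zero ((mem_homogeneousSubmodule _ _).1 hf) hd)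
      (by
        intro g hg hd
        have := HA ⟨g, memA g hd⟩
        simp only [fA, if_pos hg] at this
        exact this)
      (by
        intro a b ha hab
        by_cases ham : a = m + 1
        · have := HA ⟨w, memA w (by simp only [w, map_add, Finsupp.degree_single]; omega)⟩
          simp only [fA, if_neg hw, if_true] at this
          obtain rfl : b = 1 := by omega
          rw [ham]
          exact this
        · have hng : yz Y Z a (m - a) ∉ Gen W Y Z m :=
            fun h => std_yz hWY hWZ hYZ (by omega) (mem_of_gen h)
          have hnw : yz Y Z a (m - a) ≠ w := by
            intro h
            have := DFunLike.congr_fun h W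
            rw [yz_apply_x hWY hWZ] at this
            simp [w] at this
            omega
          have := HA ⟨yz Y Z a (m - a), memA _ (by rw [yz_degree]; omega)⟩
          simp only [fA, if_neg hng, if_neg hnw, yz_apply_Y hYZ] at this
          rwa [show m + 2 - a = b by omega] at this)
      (by
        intro i hY hZ hW e he
        exact HB (⟨i, by simp [hY, hZ, hW]⟩, ⟨e, he⟩))
      (by
        rintro e (rfl | rfl | rfl)
        · exact HC 0
        · exact HC 1
        · exact HC 2)
    -- all the values on the generators vanish
    have gen0 : ∀ g (hg : g ∈ Gen W Y Z m),
        φ.1 ⟨monomial g 1, memM g (mem_of_gen hg)⟩ = 0 := by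
      intro g hg
      obtain ⟨f, hf⟩ := Ideal.Quotient.mk_surjective
        (φ.1 ⟨monomial g 1, memM _ (mem_of_gen hg)⟩)
      rw [← hf, Ideal.Quotient.eq_zero_iff_mem, memI]
      intro u hu
      by_contra hs
      have := key g u hg hs
      rw [entry_apply k n I (memM _ (mem_of_gen hg)), ← hf, coeffQ_mk k n I (std _ hs)] at this
      exact (mem_support_iff.1 hu) this
    ext1
    ext1 ⟨x, hx⟩
    have hle : I ≤ Submodule.map I.subtype (LinearMap.ker φ.1) := by
      conv_lhs => rw [hI]
      refine Ideal.span_le.2 ?_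
      rintro _ ⟨g, hg, rfl⟩
      exact ⟨⟨monomial g 1, memM g (mem_of_gen hg)⟩, gen0 g hg, rfl⟩
    obtain ⟨⟨x', hx'⟩, h0, rfl⟩ := hle hx
    exact h0
  have := LinearMap.finrank_le_finrank_of_injective hinj
  have hA : Fintype.card A = (n + m).choose n := by
    rw [Fintype.card_coe, Finset.card_finsuppAntidiag_nat_eq_choose]
    simp only [Finset.card_univ, Fintype.card_fin]
    rw [show n + 1 + m - 1 = n + m by omega, Nat.choose_symm_add]
  have hB : Fintype.card B = n - 2 := by
    have h3 : ({W, Y, Z} : Finset (Fin (n+1))).card = 3 :=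
      Finset.card_eq_three.2 ⟨W, Y, Z, hWY, hWZ, hYZ, rfl⟩
    have : Fintype.card B = (({W, Y, Z} : Finset (Fin (n+1)))ᶜ).card := by
      rw [Fintype.card_subtype]
      congr 1
      ext i
      simp
    rw [this, Finset.card_compl, h3, Fintype.card_fin]
    omega
  rw [Module.finrank_fintype_fun_eq_card, Fintype.card_sum, Fintype.card_sum, Fintype.card_prod,
    hA, hB, Fintype.card_fin, Fintype.card_fin] at this
  omega

end HomBound

theorem finrank_hom_I0_le
    (k : Type*) [Field k] [IsAlgClosed k] (n r : ℕ) (hn : 2 ≤ n) (hr : 4 ≤ r)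
    (I₀ : Ideal (MvPolynomial (Fin (n+1)) k))
    -- `I₀` is generated by all monomials of degree `r-2` divisible by one of `α₀, …, α_{n-2}`
    -- except `α_{n-2}·αₙ^(r-3)`, together with `α_{n-2}·αₙ^(r-2)` and `α_{n-1}^r`
    (hI₀ : I₀ = Ideal.span
      ({f | ∃ c : Fin (n+1) →₀ ℕ, f = monomial c 1 ∧ c.sum (fun _ e => e) = r - 2 ∧
          (∃ i : Fin (n+1), (i : ℕ) ≤ n - 2 ∧ c i ≠ 0) ∧
          c ≠ Finsupp.single (⟨n - 2, by omega⟩ : Fin (n+1)) 1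
              + Finsupp.single (⟨n, by omega⟩ : Fin (n+1)) (r - 3)} ∪
        {X (⟨n - 2, by omega⟩ : Fin (n+1)) * X (⟨n, by omega⟩ : Fin (n+1)) ^ (r - 2),
         X (⟨n - 1, by omega⟩ : Fin (n+1)) ^ r})) :
    Module.finrank k ↥(Hom0 k n I₀ I₀) ≤ (n + r - 2).choose n + 2 * n - 1 := by
  have h := HomBound.finrank_bound k n (r - 2) hn (by omega)
    (⟨n - 2, by omega⟩ : Fin (n+1)) (⟨n - 1, by omega⟩ : Fin (n+1)) (⟨n, by omega⟩ : Fin (n+1))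
    (by simp only [ne_eq, Fin.mk.injEq]; omega) (by simp only [ne_eq, Fin.mk.injEq]; omega)
    (by simp only [ne_eq, Fin.mk.injEq]; omega) I₀ (by
      rw [hI₀]
      congr 1
      unfold HomBound.Gen
      rw [Set.image_union, Set.image_pair]
      congr 1
      · ext f
        constructor
        · rintro ⟨c, rfl, hd, ⟨i, hi, hci⟩, hne⟩
          refine ⟨c, ⟨hd, ⟨i, ?_, ?_, hci⟩, ?_⟩, rfl⟩
          · intro h; rw [Fin.ext_iff] at h; simp only at h; omega
          · intro h; rw [Fin.ext_iff] at h; simp only at h; omega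
          · rwa [show r - 2 - 1 = r - 3 by omega]
        · rintro ⟨c, ⟨hd, ⟨i, hY, hZ, hci⟩, hne⟩, rfl⟩
          refine ⟨c, rfl, hd, ⟨i, ?_, hci⟩, ?_⟩
          · have := i.2
            rw [ne_eq, Fin.ext_iff] at hY hZ
            simp only at hY hZ
            omega
          · rwa [show r - 2 - 1 = r - 3 by omega] at hne
      · rw [X_pow_eq_monomial, X_pow_eq_monomial, X, monomial_mul, one_mul,
          show r - 2 + 2 = r by omega])
  have e : n + (r - 2) = n + r - 2 := by omega
  rw [e] at h
  omega
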